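/- Let F be a free group. If (g₁,…,g_k) ∈ B^k is an aligned tuple, then (g_k^{−1},…,g₁^{−1}) ∈ B^k. Moreover, the alternating operator alt on aligned cochains, defined by alt(φ)(g₁,…,g_k) = ½(φ(g₁,…,g_k) + (−1)^{⌈k/2⌉} φ(g_k^{−1},…,g₁^{−1})), is a chain map: for every cochain φ : B^k → ℝ, alt(δφ) = δ(alt(φ)) as functions on B^{k+1}. -/

import Mathlib

open Finset

noncomputable section

/-- The space of inhomogeneous `k`-cochains on a group `G` with trivial real coefficients:
functions `G^k → ℝ`. -/
abbrev Cochain (G : Type*) (k : ℕ) := (Fin k → G) → ℝ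

/-- The cup product of inhomogeneous cochains:
`(a ∪ b)(g₁,…,g_{k+l}) = a(g₁,…,g_k) · b(g_{k+1},…,g_{k+l})`. -/
def cup {G : Type*} {k l : ℕ} (a : Cochain G k) (b : Cochain G l) : Cochain G (k + l) :=
  fun g => a (fun i => g (Fin.castAdd l i)) * b (fun i => g (Fin.natAdd k i))

/-- The inhomogeneous coboundary
`(δφ)(g₁,…,g_{k+1}) = φ(g₂,…,g_{k+1}) + Σ_{i=1}^{k} (−1)^i φ(g₁,…,g_i g_{i+1},…,g_{k+1})
  + (−1)^{k+1} φ(g₁,…,g_k)`. -/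
def cobo {G : Type*} [Group G] {k : ℕ} (a : Cochain G k) : Cochain G (k + 1) :=
  fun g =>
    a (fun i => g i.succ)
      + ∑ i : Fin k, (-1 : ℝ) ^ ((i : ℕ) + 1) *
          a (fun j => if (j : ℕ) < (i : ℕ) then g (Fin.castSucc j)
              else if (j : ℕ) = (i : ℕ) then g (Fin.castSucc j) * g j.succ
              else g j.succ)
      + (-1 : ℝ) ^ (k + 1) * a (fun i => g (Fin.castSucc i))

/-- Transport of a cochain along an equality of degrees. -/
def copyC {G : Type*} {k l : ℕ} (h : k = l) (a : Cochain G k) : Cochain G l :=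
  fun g => a fun i => g (Fin.cast h i)

/-- A cochain is bounded if it has finite sup norm. -/
def IsBoundedCochain {G : Type*} {k : ℕ} (a : Cochain G k) : Prop :=
  ∃ C, ∀ g, |a g| ≤ C

/-- The sup norm `‖a‖_∞` of a cochain. -/
def supNorm {G : Type*} {k : ℕ} (a : Cochain G k) : ℝ := ⨆ g, |a g|

variable {α : Type*} [DecidableEq α]

/-- The product `g * h` in a free group is reduced: `|gh| = |g| + |h|`. -/
def ReducedProd (g h : FreeGroup α) : Prop :=
  (g * h).norm = g.norm + h.norm

/-- The aligned tuples `B^k`: all entries are nontrivial and each product of consecutive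
entries is reduced. -/
def Aligned {k : ℕ} (g : Fin k → FreeGroup α) : Prop :=
  (∀ i, g i ≠ 1) ∧ ∀ i j : Fin k, (j : ℕ) = (i : ℕ) + 1 → ReducedProd (g i) (g j)

/-- A cochain on a free group is bounded on aligned tuples. -/
def BoundedOnAligned {k : ℕ} (a : Cochain (FreeGroup α) k) : Prop :=
  ∃ C, ∀ g, Aligned g → |a g| ≤ C

/-- A decomposition of the free group on `α`, with pieces `P` and constant `R`, in the sense
of Heuer: a map `Δ` assigning to every group element a finite sequence of pieces satisfying
(i) `g` is the reduced product of its pieces; (ii) compatibility with inverses;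
(iii) every contiguous subword of a decomposition is a decomposition;
(iv) the thick part of every geodesic triangle consists of at most `R` pieces on each side. -/
structure Decomposition (α : Type*) [DecidableEq α] where
  P : Set (FreeGroup α)
  R : ℕ
  R_pos : 0 < R
  symm : ∀ p ∈ P, p⁻¹ ∈ P
  one_notMem : (1 : FreeGroup α) ∉ P
  Δ : FreeGroup α → List (FreeGroup α)
  piece_mem : ∀ g : FreeGroup α, ∀ p ∈ Δ g, p ∈ P
  prod_eq : ∀ g : FreeGroup α, (Δ g).prod = g
  norm_eq : ∀ g : FreeGroup α, g.norm = ((Δ g).map FreeGroup.norm).sum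
  inv_eq : ∀ g : FreeGroup α, Δ (g⁻¹) = ((Δ g).reverse.map fun p => p⁻¹)
  infix_eq : ∀ (g : FreeGroup α) (l₁ l₂ l₃ : List (FreeGroup α)),
    Δ g = l₁ ++ l₂ ++ l₃ → Δ l₂.prod = l₂
  triangle : ∀ g h : FreeGroup α, ∃ c₁ c₂ c₃ r₁ r₂ r₃ : FreeGroup α,
    Δ g = Δ (c₁⁻¹) ++ Δ r₁ ++ Δ c₂ ∧
    Δ h = Δ (c₂⁻¹) ++ Δ r₂ ++ Δ c₃ ∧
    Δ ((g * h)⁻¹) = Δ (c₃⁻¹) ++ Δ r₃ ++ Δ c₁ ∧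
    (Δ r₁).length ≤ R ∧ (Δ r₂).length ≤ R ∧ (Δ r₃).length ≤ R

/-- `λ` is alternating on the pieces: `λ(p⁻¹) = −λ(p)`. -/
def IsAlternatingOnPieces (D : Decomposition α) (lam : FreeGroup α → ℝ) : Prop :=
  ∀ p ∈ D.P, lam p⁻¹ = -lam p

/-- `λ` is bounded on the pieces. -/
def BoundedOnPieces (D : Decomposition α) (lam : FreeGroup α → ℝ) : Prop :=
  ∃ C, ∀ p ∈ D.P, |lam p| ≤ C

/-- The `Δ`-decomposable quasi-morphism `φ_{λ,Δ}(g) = Σ_j λ(g^{(j)})`. -/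
def qm (D : Decomposition α) (lam : FreeGroup α → ℝ) (g : FreeGroup α) : ℝ :=
  ((D.Δ g).map lam).sum

/-- `φ_{λ,Δ}` viewed as a `1`-cochain. -/
def qmC (D : Decomposition α) (lam : FreeGroup α → ℝ) : Cochain (FreeGroup α) 1 :=
  fun g => qm D lam (g 0)

/-- `z^<_{j+1}(g)`: the product of the first `j` pieces of `g` (`j` is 0-indexed). -/
def zlt (D : Decomposition α) (g : FreeGroup α) (j : ℕ) : FreeGroup α :=
  ((D.Δ g).take j).prod

/-- `z^>_{j+1}(g)`: the product of the pieces of `g` after the `(j+1)`-st (`j` is 0-indexed). -/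
def zgt (D : Decomposition α) (g : FreeGroup α) (j : ℕ) : FreeGroup α :=
  ((D.Δ g).drop (j + 1)).prod

/-- `g^{(j+1)}`: the `(j+1)`-st piece of `g` (`j` is 0-indexed). -/
def piece (D : Decomposition α) (g : FreeGroup α) (j : ℕ) : FreeGroup α :=
  (D.Δ g).getD j 1

/-- `η₁(g₁,…,g_{k₁}) = Σ_{j=1}^{|Δ(g_{k₁})|} ω₁(g₁,…,g_{k₁−1}, z^<_j(g_{k₁}))·φ(g_{k₁}^{(j)})`. -/
def eta1 {m₁ : ℕ} (D : Decomposition α) (lam : FreeGroup α → ℝ)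
    (ω₁ : Cochain (FreeGroup α) (m₁ + 1)) : Cochain (FreeGroup α) (m₁ + 1) :=
  fun g => ∑ j ∈ Finset.range (D.Δ (g (Fin.last m₁))).length,
    ω₁ (Function.update g (Fin.last m₁) (zlt D (g (Fin.last m₁)) j)) *
      qm D lam (piece D (g (Fin.last m₁)) j)

/-- `η₂(h₁,…,h_{k₂}) = Σ_{j=1}^{|Δ(h₁)|} φ(h₁^{(j)})·ω₂(z^>_j(h₁), h₂,…,h_{k₂})`. -/
def eta2 {m₂ : ℕ} (D : Decomposition α) (lam : FreeGroup α → ℝ)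
    (ω₂ : Cochain (FreeGroup α) (m₂ + 1)) : Cochain (FreeGroup α) (m₂ + 1) :=
  fun h => ∑ j ∈ Finset.range (D.Δ (h 0)).length,
    qm D lam (piece D (h 0) j) * ω₂ (Function.update h 0 (zgt D (h 0) j))

/-- `η(g₁,…,g_{k₁−1}, e, h₂,…,h_{k₂})
  = Σ_{j=1}^{|Δ(e)|} ω₁(g₁,…,g_{k₁−1}, z^<_j(e))·φ(e^{(j)})·ω₂(z^>_j(e), h₂,…,h_{k₂})`,
where `e` sits in position `k₁` of the `(k₁+k₂−1)`-tuple. -/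
def etaM {m₁ m₂ : ℕ} (D : Decomposition α) (lam : FreeGroup α → ℝ)
    (ω₁ : Cochain (FreeGroup α) (m₁ + 1)) (ω₂ : Cochain (FreeGroup α) (m₂ + 1)) :
    Cochain (FreeGroup α) (m₁ + m₂ + 1) :=
  fun x =>
    ∑ j ∈ Finset.range (D.Δ (x ⟨m₁, by omega⟩)).length,
      ω₁ (Fin.snoc (fun i : Fin m₁ => x (Fin.castLE (by omega) i))
            (zlt D (x ⟨m₁, by omega⟩) j)) *
        qm D lam (piece D (x ⟨m₁, by omega⟩) j) *
        ω₂ (Fin.cons (zgt D (x ⟨m₁, by omega⟩) j)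
            (fun i : Fin m₂ => x ⟨m₁ + 1 + (i : ℕ), by have := i.isLt; omega⟩))

/-- The alternating operator on aligned cochains. -/
def altC {α : Type*} [DecidableEq α] {k : ℕ} (φ : Cochain (FreeGroup α) k) :
    Cochain (FreeGroup α) k :=
  fun g => (φ g + (-1 : ℝ) ^ ((k + 1) / 2) * φ fun i => (g i.rev)⁻¹) / 2

theorem cobo_rev_aux {G : Type*} [Group G] {k : ℕ} (φ : Cochain G k) (x : Fin (k + 1) → G) :
    cobo (fun g : Fin k → G => φ fun i => (g i.rev)⁻¹) x
      = (-1 : ℝ) ^ (k + 1) * cobo φ (fun i => (x i.rev)⁻¹) := by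
  have hs : (-1 : ℝ) ^ (k + 1) * (-1 : ℝ) ^ (k + 1) = 1 := by
    rw [← mul_pow]; norm_num
  unfold cobo
  simp only [Fin.rev_succ, Fin.rev_castSucc]
  rw [mul_add, mul_add, ← mul_assoc ((-1 : ℝ) ^ (k + 1)), hs, one_mul]
  have hsum : (∑ i : Fin k, (-1 : ℝ) ^ ((i : ℕ) + 1) *
      φ (fun j => (if (j.rev : ℕ) < (i : ℕ) then x (Fin.castSucc j.rev)
              else if (j.rev : ℕ) = (i : ℕ) then x (Fin.castSucc j.rev) * x j.rev.succ
              else x j.rev.succ)⁻¹)) =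
      (-1 : ℝ) ^ (k + 1) * ∑ i : Fin k, (-1 : ℝ) ^ ((i : ℕ) + 1) *
      φ (fun j => if (j : ℕ) < (i : ℕ) then (x j.rev.succ)⁻¹
              else if (j : ℕ) = (i : ℕ) then (x j.rev.succ)⁻¹ * (x j.rev.castSucc)⁻¹
              else (x j.rev.castSucc)⁻¹) := by
    rw [Finset.mul_sum, ← Equiv.sum_comp Fin.revPerm]
    refine Finset.sum_congr rfl fun i _ => ?_
    rw [← mul_assoc]
    congr 1
    · rw [Fin.revPerm_apply, Fin.val_rev]
      have hi := i.isLt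
      have e : k + 1 + ((i : ℕ) + 1) = (k - ((i : ℕ) + 1) + 1) + 2 * ((i : ℕ) + 1) := by omega
      rw [← pow_add, e, pow_add _ _ (2 * _), pow_mul]
      norm_num
    · congr 1
      funext j
      have hi := i.isLt
      have hj := j.isLt
      simp only [Fin.revPerm_apply, Fin.val_rev]
      rcases lt_trichotomy (j : ℕ) (i : ℕ) with h | h | h
      · rw [if_neg (by omega), if_neg (by omega), if_pos h]
      · rw [if_neg (by omega), if_pos (by omega), if_neg (by omega), if_pos h, mul_inv_rev]
      · rw [if_pos (by omega), if_neg (by omega), if_neg (by omega)]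
  rw [hsum]
  ring

theorem cobo_lin_aux {G : Type*} [Group G] {k : ℕ} (a b : Cochain G k) (c : ℝ)
    (x : Fin (k + 1) → G) :
    cobo (fun g => (a g + c * b g) / 2) x = (cobo a x + c * cobo b x) / 2 := by
  unfold cobo
  have : ∀ f g e : Fin k → ℝ, ∑ i, e i * ((f i + c * g i) / 2)
      = ((∑ i, e i * f i) + c * ∑ i, e i * g i) / 2 := by
    intro f g e
    rw [Finset.mul_sum, ← Finset.sum_add_distrib, Finset.sum_div]
    exact Finset.sum_congr rfl fun i _ => by ring
  rw [this]
  ring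

theorem sign_aux (k : ℕ) :
    (-1 : ℝ) ^ ((k + 1 + 1) / 2) = (-1) ^ ((k + 1) / 2) * (-1) ^ (k + 1) := by
  rcases Nat.even_or_odd' k with ⟨m, rfl | rfl⟩
  · rw [show (2 * m + 1 + 1) / 2 = m + 1 by omega, show (2 * m + 1) / 2 = m by omega]
    simp [pow_succ, pow_mul]
  · rw [show (2 * m + 1 + 1 + 1) / 2 = m + 1 by omega, show (2 * m + 1 + 1) / 2 = m + 1 by omega]
    simp [pow_succ, pow_mul]

/-- Aligned tuples are stable under reversing and inverting the entries, and the
alternating operator is a chain map on the aligned cochain complex: `alt(δφ) = δ(alt φ)`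
as functions on aligned tuples. -/
theorem aligned_rev_inv_and_alt_chain_map {α : Type*} [DecidableEq α] :
    (∀ (k : ℕ) (g : Fin k → FreeGroup α), Aligned g → Aligned fun i => (g i.rev)⁻¹) ∧
    ∀ (k : ℕ) (φ : Cochain (FreeGroup α) k) (x : Fin (k + 1) → FreeGroup α), Aligned x →
      altC (cobo φ) x = cobo (altC φ) x := by
  refine ⟨fun k g hg => ⟨fun i => inv_ne_one.mpr (hg.1 _), fun i j hij => ?_⟩, fun k φ x _ => ?_⟩
  · have hj := j.isLt
    have h := hg.2 j.rev i.rev (by rw [Fin.val_rev, Fin.val_rev]; omega)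
    unfold ReducedProd at h ⊢
    rw [← mul_inv_rev, FreeGroup.norm_inv_eq, FreeGroup.norm_inv_eq, FreeGroup.norm_inv_eq, h,
      add_comm]
  · have h := cobo_lin_aux φ (fun g => φ fun i => (g i.rev)⁻¹) ((-1 : ℝ) ^ ((k + 1) / 2)) x
    rw [cobo_rev_aux, ← mul_assoc, ← sign_aux] at h
    exact h.symm
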